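/- arXiv:2403.05254 — 2 statements merged into one kernel-verified Lean document; each statement's English description precedes it below -/
import Mathlib

section
/- Let G be a finite simple graph with at least one edge which is not regular, and let G⁽¹⁾ be the graph obtained from two disjoint copies G′ and G″ of G by adding, for each vertex v of G with degree d_G(v) < Δ(G), an edge joining the copy of v in G′ to the copy of v in G″. Then Δ(G⁽¹⁾) = Δ(G), δ(G⁽¹⁾) = δ(G) + 1, and es_Δ(G⁽¹⁾) ≥ 2·es_Δ(G); in particular |V(G⁽¹⁾)|/es_Δ(G⁽¹⁾) ≤ |V(G)|/es_Δ(G). -/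
open SimpleGraph

attribute [local instance] Classical.propDecidable

universe u

variable {V : Type u}

/-- A set of edges of `G` is *mitigating* if its removal decreases the maximum degree
of `G` by exactly one. -/
def SimpleGraph.IsMitigating [Fintype V] (G : SimpleGraph V) (S : Set (Sym2 V)) : Prop :=
  S ⊆ G.edgeSet ∧ (G.deleteEdges S).maxDegree = G.maxDegree - 1

/-- The Δ-edge stability number `es_Δ(G)`: the minimum cardinality of a mitigating set. -/
noncomputable def SimpleGraph.esDelta [Fintype V] (G : SimpleGraph V) : ℕ :=
  sInf {n | ∃ S : Set (Sym2 V), G.IsMitigating S ∧ S.ncard = n}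

/-- The graph `G⁽¹⁾` built from two disjoint copies of `G` by joining the two copies of
each vertex of non-maximum degree by an edge. -/
noncomputable def SimpleGraph.regStep [Fintype V] (G : SimpleGraph V) :
    SimpleGraph (V ⊕ V) :=
  SimpleGraph.fromRel (fun x y =>
    match x, y with
    | Sum.inl u, Sum.inl v => G.Adj u v
    | Sum.inr u, Sum.inr v => G.Adj u v
    | Sum.inl u, Sum.inr v => u = v ∧ G.degree u < G.maxDegree
    | Sum.inr _, Sum.inl _ => False)

namespace SimpleGraph

variable [Fintype V]

/-- Deleting one more edge lowers the maximum degree by at most one. -/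
theorem maxDegree_deleteEdges_le_add_one (G : SimpleGraph V) {S T : Set (Sym2 V)}
    {e : Sym2 V} (h : S ⊆ insert e T) :
    (G.deleteEdges T).maxDegree ≤ (G.deleteEdges S).maxDegree + 1 := by
  refine maxDegree_le_of_forall_degree_le _ _ fun v => ?_
  refine le_trans ?_ (Nat.add_le_add_right ((G.deleteEdges S).degree_le_maxDegree v) 1)
  rw [← card_neighborFinset_eq_degree, ← card_neighborFinset_eq_degree]
  by_cases hv : v ∈ e
  · refine le_trans (Finset.card_le_card fun w hw => ?_)
      (Finset.card_insert_le (Sym2.Mem.other hv) ((G.deleteEdges S).neighborFinset v))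
    simp only [mem_neighborFinset, deleteEdges_adj, Finset.mem_insert] at hw ⊢
    by_cases hS : s(v, w) ∈ S
    · left
      have he := (h hS).resolve_right hw.2
      rw [← Sym2.other_spec hv] at he
      exact Sym2.congr_right.mp he
    · exact Or.inr ⟨hw.1, hS⟩
  · refine le_trans (Finset.card_le_card fun w hw => ?_) (Nat.le_succ _)
    simp only [mem_neighborFinset, deleteEdges_adj] at hw ⊢
    refine ⟨hw.1, fun hS => hv ?_⟩
    rw [← (h hS).resolve_right hw.2]
    exact Sym2.mem_mk_left v w

/-- Every set of edges whose removal lowers the maximum degree contains a mitigating set. -/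
theorem exists_isMitigating_subset (G : SimpleGraph V) (hG : 0 < G.maxDegree)
    {S : Set (Sym2 V)} (hS : S ⊆ G.edgeSet)
    (hdeg : (G.deleteEdges S).maxDegree ≤ G.maxDegree - 1) :
    ∃ T ⊆ S, G.IsMitigating T := by
  obtain ⟨T, hTS, hT⟩ := exists_minimal_le_of_wellFoundedLT
    (fun T : Set (Sym2 V) => (G.deleteEdges T).maxDegree ≤ G.maxDegree - 1) S hdeg
  have hprop : (G.deleteEdges T).maxDegree ≤ G.maxDegree - 1 := hT.prop
  refine ⟨T, hTS, hTS.trans hS, le_antisymm hprop ?_⟩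
  have hne : T.Nonempty := by
    rw [Set.nonempty_iff_ne_empty]
    rintro rfl
    simp only [deleteEdges_empty] at hprop
    omega
  obtain ⟨e, he⟩ := hne
  have hlt := hT.not_prop_of_lt (Set.sdiff_singleton_ssubset.mpr he)
  have hsub : T ⊆ insert e (T \ {e}) := by simp
  have hle := G.maxDegree_deleteEdges_le_add_one hsub
  exact Nat.le_of_lt_succ ((not_le.mp hlt).trans_le hle)

theorem exists_isMitigating (G : SimpleGraph V) (hG : 0 < G.maxDegree) :
    ∃ S, G.IsMitigating S := by
  obtain ⟨T, -, hT⟩ := G.exists_isMitigating_subset hG (S := G.edgeSet) subset_rfl <| by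
    refine maxDegree_le_of_forall_degree_le _ _ fun v => ?_
    rw [← card_neighborFinset_eq_degree, Finset.card_eq_zero.mpr]
    · exact Nat.zero_le _
    · ext w
      simp
  exact ⟨T, hT⟩

theorem esDelta_le_ncard (G : SimpleGraph V) {S : Set (Sym2 V)} (hS : G.IsMitigating S) :
    G.esDelta ≤ S.ncard :=
  Nat.sInf_le ⟨S, hS, rfl⟩

theorem exists_isMitigating_ncard_eq_esDelta (G : SimpleGraph V) (hG : 0 < G.maxDegree) :
    ∃ S, G.IsMitigating S ∧ S.ncard = G.esDelta := by
  obtain ⟨S, hS⟩ := G.exists_isMitigating hG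
  exact Nat.sInf_mem (s := {n | ∃ S : Set (Sym2 V), G.IsMitigating S ∧ S.ncard = n})
    ⟨S.ncard, S, hS, rfl⟩

theorem esDelta_pos (G : SimpleGraph V) (hG : 0 < G.maxDegree) : 0 < G.esDelta := by
  obtain ⟨S, hS, hcard⟩ := G.exists_isMitigating_ncard_eq_esDelta hG
  rw [← hcard, Set.ncard_pos, Set.nonempty_iff_ne_empty]
  rintro rfl
  have h := hS.2
  simp only [deleteEdges_empty] at h
  omega

/-- A mitigating set of `H` restricts to at least `es_Δ(G)` edges on every induced copy of `G`
in `H` of the same maximum degree. -/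
theorem esDelta_le_ncard_preimage {W : Type*} [Fintype W] {G : SimpleGraph V}
    {H : SimpleGraph W} (f : G ↪g H) (hG : 0 < G.maxDegree)
    (hGH : H.maxDegree = G.maxDegree) {S : Set (Sym2 W)} (hS : H.IsMitigating S) :
    G.esDelta ≤ (Sym2.map f ⁻¹' S).ncard := by
  obtain ⟨T, hTS, hT⟩ := G.exists_isMitigating_subset hG (S := Sym2.map f ⁻¹' S)
    (fun e he => (f.map_mem_edgeSet_iff).mp (hS.1 he)) <| by
      refine maxDegree_le_of_forall_degree_le _ _ fun v => ?_
      rw [← hGH, ← hS.2]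
      refine le_trans ?_ ((H.deleteEdges S).degree_le_maxDegree (f v))
      rw [← card_neighborFinset_eq_degree, ← card_neighborFinset_eq_degree,
        ← Finset.card_map f.toEmbedding]
      refine Finset.card_le_card fun w hw => ?_
      obtain ⟨u, hu, rfl⟩ := Finset.mem_map.mp hw
      simpa using hu
  exact (G.esDelta_le_ncard hT).trans (Set.ncard_le_ncard hTS)

@[simp]
theorem regStep_adj_inl_inl (G : SimpleGraph V) (u v : V) :
    G.regStep.Adj (Sum.inl u) (Sum.inl v) ↔ G.Adj u v := by
  simp only [regStep, fromRel_adj, ne_eq, Sum.inl.injEq, G.adj_comm v u, or_self]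
  exact ⟨And.right, fun h => ⟨h.ne, h⟩⟩

@[simp]
theorem regStep_adj_inr_inr (G : SimpleGraph V) (u v : V) :
    G.regStep.Adj (Sum.inr u) (Sum.inr v) ↔ G.Adj u v := by
  simp only [regStep, fromRel_adj, ne_eq, Sum.inr.injEq, G.adj_comm v u, or_self]
  exact ⟨And.right, fun h => ⟨h.ne, h⟩⟩

@[simp]
theorem regStep_adj_inl_inr (G : SimpleGraph V) (u v : V) :
    G.regStep.Adj (Sum.inl u) (Sum.inr v) ↔ u = v ∧ G.degree u < G.maxDegree := by
  simp [regStep, fromRel_adj]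

@[simp]
theorem regStep_adj_inr_inl (G : SimpleGraph V) (u v : V) :
    G.regStep.Adj (Sum.inr u) (Sum.inl v) ↔ v = u ∧ G.degree v < G.maxDegree := by
  simp [regStep, fromRel_adj]

theorem degree_regStep_inl (G : SimpleGraph V) (v : V) :
    G.regStep.degree (Sum.inl v) =
      G.degree v + if G.degree v < G.maxDegree then 1 else 0 := by
  have h : G.regStep.neighborFinset (Sum.inl v) =
      (G.neighborFinset v).disjSum (if G.degree v < G.maxDegree then {v} else ∅) := by
    ext (w | w)
    · simp
    · split_ifs with hv <;> simp [hv, eq_comm]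
  rw [← card_neighborFinset_eq_degree, h, Finset.card_disjSum, card_neighborFinset_eq_degree]
  split_ifs <;> simp

theorem degree_regStep_inr (G : SimpleGraph V) (v : V) :
    G.regStep.degree (Sum.inr v) =
      G.degree v + if G.degree v < G.maxDegree then 1 else 0 := by
  have h : G.regStep.neighborFinset (Sum.inr v) =
      (if G.degree v < G.maxDegree then {v} else ∅ : Finset V).disjSum
        (G.neighborFinset v) := by
    ext (w | w)
    · split_ifs with hv <;> simp <;> grind
    · simp
  rw [← card_neighborFinset_eq_degree, h, Finset.card_disjSum, card_neighborFinset_eq_degree,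
    add_comm]
  split_ifs <;> simp

theorem maxDegree_regStep [Nonempty V] (G : SimpleGraph V) :
    G.regStep.maxDegree = G.maxDegree := by
  apply le_antisymm
  · refine maxDegree_le_of_forall_degree_le _ _ ?_
    rintro (v | v)
    · have := G.degree_le_maxDegree v
      rw [degree_regStep_inl]
      split_ifs <;> omega
    · have := G.degree_le_maxDegree v
      rw [degree_regStep_inr]
      split_ifs <;> omega
  · obtain ⟨v, hv⟩ := G.exists_maximal_degree_vertex
    have h := G.regStep.degree_le_maxDegree (Sum.inl v)
    rw [degree_regStep_inl] at h
    omega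

theorem minDegree_regStep [Nonempty V] (G : SimpleGraph V) (h : G.minDegree < G.maxDegree) :
    G.regStep.minDegree = G.minDegree + 1 := by
  apply le_antisymm
  · obtain ⟨v, hv⟩ := G.exists_minimal_degree_vertex
    have hle := G.regStep.minDegree_le_degree (Sum.inl v)
    rw [degree_regStep_inl, if_pos (hv ▸ h), ← hv] at hle
    exact hle
  · refine le_minDegree_of_forall_le_degree _ _ ?_
    rintro (v | v)
    · have := G.minDegree_le_degree v
      rw [degree_regStep_inl]
      split_ifs <;> omega
    · have := G.minDegree_le_degree v
      rw [degree_regStep_inr]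
      split_ifs <;> omega

theorem minDegree_lt_maxDegree (G : SimpleGraph V) (h : ¬ ∃ k, G.IsRegularOfDegree k) :
    G.minDegree < G.maxDegree := by
  by_contra! hle
  exact h ⟨G.maxDegree, fun v =>
    le_antisymm (G.degree_le_maxDegree v) (hle.trans (G.minDegree_le_degree v))⟩

/-- The first copy of `G` inside `G⁽¹⁾`. -/
noncomputable def regStepInl (G : SimpleGraph V) : G ↪g G.regStep where
  toEmbedding := Function.Embedding.inl
  map_rel_iff' := G.regStep_adj_inl_inl _ _

/-- The second copy of `G` inside `G⁽¹⁾`. -/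
noncomputable def regStepInr (G : SimpleGraph V) : G ↪g G.regStep where
  toEmbedding := Function.Embedding.inr
  map_rel_iff' := G.regStep_adj_inr_inr _ _

theorem two_mul_esDelta_le_esDelta_regStep [Nonempty V] (G : SimpleGraph V)
    (hG : 0 < G.maxDegree) : 2 * G.esDelta ≤ G.regStep.esDelta := by
  have hmax := G.maxDegree_regStep
  obtain ⟨S, hS, hcard⟩ := G.regStep.exists_isMitigating_ncard_eq_esDelta (hmax ▸ hG)
  have hl := esDelta_le_ncard_preimage G.regStepInl hG hmax hS
  have hr := esDelta_le_ncard_preimage G.regStepInr hG hmax hS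
  rw [← Set.ncard_image_of_injective _ (Sym2.map.injective G.regStepInl.injective)] at hl
  rw [← Set.ncard_image_of_injective _ (Sym2.map.injective G.regStepInr.injective)] at hr
  have hdisj : Disjoint
      (Sym2.map G.regStepInl '' (Sym2.map G.regStepInl ⁻¹' S))
      (Sym2.map G.regStepInr '' (Sym2.map G.regStepInr ⁻¹' S)) := by
    rw [Set.disjoint_left]
    rintro _ ⟨a, -, rfl⟩ ⟨b, -, hb⟩
    induction a with | _ u v
    have hu : Sum.inl u ∈ Sym2.map G.regStepInr b := hb ▸ Sym2.mem_mk_left _ _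
    obtain ⟨w, -, hw⟩ := Sym2.mem_map.mp hu
    exact Sum.inr_ne_inl hw
  have hle := Set.ncard_le_ncard (t := S) (Set.union_subset
    (Set.image_preimage_subset (Sym2.map G.regStepInl) S)
    (Set.image_preimage_subset (Sym2.map G.regStepInr) S))
  rw [Set.ncard_union_eq hdisj] at hle
  omega

end SimpleGraph

/-- For a non-regular graph `G` with at least one edge: `Δ(G⁽¹⁾) = Δ(G)`,
`δ(G⁽¹⁾) = δ(G) + 1`, `es_Δ(G⁽¹⁾) ≥ 2·es_Δ(G)`, and hence
`|V(G⁽¹⁾)|/es_Δ(G⁽¹⁾) ≤ |V(G)|/es_Δ(G)`. -/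
theorem stmt_5 [Fintype V] (G : SimpleGraph V) (hE : G.edgeSet.Nonempty)
    (hnotreg : ¬ ∃ k, G.IsRegularOfDegree k) :
    G.regStep.maxDegree = G.maxDegree ∧
    G.regStep.minDegree = G.minDegree + 1 ∧
    2 * G.esDelta ≤ G.regStep.esDelta ∧
    (Fintype.card (V ⊕ V) : ℝ) / G.regStep.esDelta ≤
      (Fintype.card V : ℝ) / G.esDelta := by
  have hlt := G.minDegree_lt_maxDegree hnotreg
  have hG : 0 < G.maxDegree := by omega
  have : Nonempty V := ⟨hE.choose.out.1⟩
  have hes := G.two_mul_esDelta_le_esDelta_regStep hG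
  refine ⟨G.maxDegree_regStep, G.minDegree_regStep hlt, hes, ?_⟩
  have hpos : (0 : ℝ) < G.esDelta := by exact_mod_cast G.esDelta_pos hG
  have hes' : (2 : ℝ) * G.esDelta ≤ G.regStep.esDelta := by exact_mod_cast hes
  rw [Fintype.card_sum, div_le_div_iff₀ (by linarith) hpos]
  push_cast
  have := mul_le_mul_of_nonneg_left hes' (Nat.cast_nonneg (α := ℝ) (Fintype.card V))
  linarith
end

section
/- Let k ≥ 3 be an odd integer and let G be a connected k-regular finite simple graph of order n. Then es_Δ(G) ≤ ((k³ + k² − 6k + 2)·n + 2k − 2) / (2(k³ − 3k)). -/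
open SimpleGraph

attribute [local instance] Classical.propDecidable

universe u

variable {V : Type u}

theorem SimpleGraph.esDelta_le_of_edgeCover [Fintype V] [Nonempty V] {G : SimpleGraph V} {k : ℕ}
    (hreg : G.IsRegularOfDegree k) {S : Set (Sym2 V)} (hS : S ⊆ G.edgeSet)
    (hcov : ∀ v, ∃ e ∈ S, v ∈ e) : G.esDelta ≤ S.ncard := by
  obtain ⟨T, hTS, hT⟩ := exists_minimal_le_of_wellFoundedLT
    (fun T : Set (Sym2 V) => ∀ v, ∃ e ∈ T, v ∈ e) S hcov
  have hTG : T ⊆ G.edgeSet := fun e he => hS (hTS he)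
  suffices hmit : G.IsMitigating T from
    (Nat.sInf_le (show T.ncard ∈ {n | ∃ S, G.IsMitigating S ∧ S.ncard = n} from
      ⟨T, hmit, rfl⟩)).trans (Set.ncard_le_ncard hTS S.toFinite)
  refine ⟨hTG, ?_⟩
  rw [hreg.maxDegree_eq]
  apply le_antisymm
  · refine maxDegree_le_of_forall_degree_le _ _ fun v => ?_
    obtain ⟨e, he, hv⟩ := hT.1 v
    obtain ⟨w, rfl⟩ := Sym2.mem_iff_exists.1 hv
    have : ((G.deleteEdges T).neighborFinset v) ⊆ (G.neighborFinset v).erase w := by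
      intro x hx
      simp only [mem_neighborFinset, deleteEdges_adj, Finset.mem_erase] at hx ⊢
      refine ⟨?_, hx.1⟩
      rintro rfl
      exact hx.2 he
    have h2 := Finset.card_le_card this
    have hvw : w ∈ G.neighborFinset v := by simpa using hTG he
    rw [Finset.card_erase_of_mem hvw] at h2
    simpa [hreg.degree_eq] using h2
  · obtain ⟨e, he, -⟩ := hT.1 (Classical.arbitrary V)
    have hnot : ¬ ∀ v, ∃ f ∈ T \ {e}, v ∈ f := fun h =>
      (hT.2 h Set.sdiff_subset he).2 rfl
    push Not at hnot
    obtain ⟨v, hv⟩ := hnot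
    have hve : ∀ f ∈ T, v ∈ f → f = e := fun f hf hvf => by
      by_contra hne
      exact hv f ⟨hf, hne⟩ hvf
    refine le_trans ?_ (degree_le_maxDegree _ v)
    obtain ⟨f, hf, hvf⟩ := hT.1 v
    obtain rfl := hve f hf hvf
    obtain ⟨w, rfl⟩ := Sym2.mem_iff_exists.1 hvf
    have : (G.neighborFinset v).erase w ⊆ (G.deleteEdges T).neighborFinset v := by
      intro x hx
      simp only [mem_neighborFinset, deleteEdges_adj, Finset.mem_erase] at hx ⊢
      refine ⟨hx.2, fun hxT => hx.1 ?_⟩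
      exact Sym2.congr_right.1 (hve _ hxT (Sym2.mem_mk_left _ _))
    have h2 := Finset.card_le_card this
    have hvw : w ∈ G.neighborFinset v := by simpa using hTG he
    rw [Finset.card_erase_of_mem hvw] at h2
    simpa [hreg.degree_eq] using h2

theorem SimpleGraph.Iso.ncard_oddComponents_le {W : Type*} [Finite W] {G : SimpleGraph V}
    {H : SimpleGraph W} (φ : G ≃g H) : G.oddComponents.ncard ≤ H.oddComponents.ncard := by
  refine Set.ncard_le_ncard_of_injOn φ.connectedComponentEquiv (fun C hC => ?_)
    φ.connectedComponentEquiv.injective.injOn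
  have : C.supp.ncard = (φ.connectedComponentEquiv C).supp.ncard :=
    Nat.card_congr (ConnectedComponent.isoEquivSupp φ C)
  rwa [Set.mem_ofPred_eq, this] at hC

theorem SimpleGraph.ncard_add_card_connectedComponent_le [Fintype V] {G : SimpleGraph V} {k : ℕ}
    (hreg : G.IsRegularOfDegree k) (hconn : G.Connected) (U : Set V) :
    U.ncard + Nat.card (G.induce Uᶜ).ConnectedComponent ≤ k * U.ncard + 1 := by
  let f : V → U ⊕ (G.induce Uᶜ).ConnectedComponent := fun v =>
    if h : v ∈ U then Sum.inl ⟨v, h⟩ else Sum.inr ((G.induce Uᶜ).connectedComponentMk ⟨v, h⟩)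
  have hf : Function.Surjective f := by
    rintro (⟨v, hv⟩ | C)
    · exact ⟨v, by simp [f, hv]⟩
    · obtain ⟨⟨v, hv⟩, rfl⟩ := C.exists_rep
      have hv' : v ∉ U := hv
      exact ⟨v, by simp [f, hv']; rfl⟩
  let E : Set (Sym2 (U ⊕ (G.induce Uᶜ).ConnectedComponent)) :=
    Sym2.map f '' ⋃ u ∈ U, G.incidenceSet u
  have hE : E.ncard ≤ k * U.ncard := by
    refine (Set.ncard_image_le (Set.toFinite _)).trans ?_
    rw [Set.ncard_eq_toFinset_card' U]
    have := U.toFinset.set_ncard_biUnion_le (fun u => G.incidenceSet u)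
    simp only [Set.mem_toFinset] at this
    refine this.trans ?_
    rw [mul_comm, ← smul_eq_mul]
    refine Finset.sum_le_card_nsmul _ _ _ fun u _ => ?_
    rw [Set.ncard_eq_toFinset_card', Set.toFinset_card, card_incidenceSet_eq_degree,
      hreg.degree_eq]
  have hadj : ∀ x y, G.Adj x y → (fromEdgeSet E).Reachable (f x) (f y) := by
    intro x y hxy
    by_cases hne : f x = f y
    · rw [hne]
    by_cases hU : x ∈ U ∨ y ∈ U
    · refine Adj.reachable ((fromEdgeSet_adj _).2 ⟨⟨s(x, y), ?_, rfl⟩, hne⟩)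
      rcases hU with h | h
      · exact Set.mem_biUnion h ⟨hxy, Sym2.mem_mk_left _ _⟩
      · exact Set.mem_biUnion h ⟨hxy, Sym2.mem_mk_right _ _⟩
    · push Not at hU
      refine (hne ?_).elim
      simp only [f, hU.1, hU.2, dite_false]
      congr 1
      exact ConnectedComponent.sound (Adj.reachable (by simpa using hxy))
  have hcon : (fromEdgeSet E).Connected := by
    have : Nonempty (U ⊕ (G.induce Uᶜ).ConnectedComponent) := hconn.nonempty.map f
    refine ⟨fun a b => ?_⟩
    obtain ⟨x, rfl⟩ := hf a
    obtain ⟨y, rfl⟩ := hf b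
    obtain ⟨p⟩ := hconn.preconnected x y
    induction p with
    | nil => rfl
    | cons h _ ih => exact (hadj _ _ h).trans ih
  have := hcon.card_vert_le_card_edgeSet_add_one
  rw [Nat.card_sum, Nat.card_coe_set_eq, Nat.card_coe_set_eq, edgeSet_fromEdgeSet] at this
  have h2 : (E \ Sym2.diagSet).ncard ≤ E.ncard := Set.ncard_le_ncard Set.sdiff_subset
  omega

/-- The join of `G` with a complete graph on `d` vertices. -/
def SimpleGraph.joinComplete (G : SimpleGraph V) (d : ℕ) : SimpleGraph (V ⊕ Fin d) where
  Adj x y := x ≠ y ∧ ∀ v w, x = Sum.inl v → y = Sum.inl w → G.Adj v w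
  symm := ⟨fun _ _ h => ⟨h.1.symm, fun v w hv hw => (h.2 w v hw hv).symm⟩⟩
  loopless := ⟨fun _ h => h.1 rfl⟩

theorem SimpleGraph.joinComplete_adj_inl_inl {G : SimpleGraph V} {d : ℕ} {v w : V} :
    (G.joinComplete d).Adj (Sum.inl v) (Sum.inl w) ↔ G.Adj v w := by
  constructor
  · exact fun h => h.2 v w rfl rfl
  · intro h
    refine ⟨fun h' => h.ne (Sum.inl_injective h'), ?_⟩
    rintro _ _ ⟨⟩ ⟨⟩
    exact h

theorem SimpleGraph.joinComplete_adj_inr {G : SimpleGraph V} {d : ℕ} {x : V ⊕ Fin d} {i : Fin d}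
    (h : x ≠ Sum.inr i) : (G.joinComplete d).Adj x (Sum.inr i) :=
  ⟨h, fun _ _ _ h' => by simp at h'⟩

theorem SimpleGraph.exists_isPerfectMatching_joinComplete [Fintype V] {G : SimpleGraph V} {d : ℕ}
    (hd : Even (Fintype.card V + d))
    (h : ∀ U : Set V, (G.induce Uᶜ).oddComponents.ncard ≤ U.ncard + d) :
    ∃ M : (G.joinComplete d).Subgraph, M.IsPerfectMatching := by
  refine tutte.2 fun W hW => ?_
  rw [IsTutteViolator] at hW
  by_cases hWd : ∃ i, Sum.inr i ∉ W
  · obtain ⟨i, hi⟩ := hWd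
    set H := ((⊤ : (G.joinComplete d).Subgraph).deleteVerts W).coe with hH
    let z : ((⊤ : (G.joinComplete d).Subgraph).deleteVerts W).verts :=
      ⟨Sum.inr i, by simpa using hi⟩
    have hpre : ∀ x, H.Reachable x z := by
      intro x
      by_cases hxz : x = z
      · rw [hxz]
      · refine Adj.reachable ?_
        have hx : (x : V ⊕ Fin d) ≠ Sum.inr i := fun h => hxz (Subtype.ext h)
        have hxW : (x : V ⊕ Fin d) ∉ W := by simpa using x.2
        simp [hH, z, hxW, hi, joinComplete_adj_inr hx]
    have hsub : Subsingleton H.ConnectedComponent :=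
      Preconnected.subsingleton_connectedComponent fun x y => (hpre x).trans (hpre y).symm
    have h1 : H.oddComponents.ncard ≤ 1 := Set.ncard_le_one_of_subsingleton _
    have hW0 : W = ∅ := (Set.ncard_eq_zero W.toFinite).1 (by omega)
    have hodd : Odd H.oddComponents.ncard := by
      rw [show H.oddComponents.ncard = 1 by omega]
      exact odd_one
    rw [odd_ncard_oddComponents] at hodd
    rw [hW0] at hodd
    have : Nat.card ((⊤ : (G.joinComplete d).Subgraph).deleteVerts ∅).verts
        = Fintype.card V + d := by
      simp [Nat.card_eq_fintype_card]
    rw [this] at hodd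
    exact Nat.not_even_iff_odd.2 hodd hd
  · push Not at hWd
    have hWU : W = Sum.inl '' (Sum.inl ⁻¹' W : Set V) ∪ Set.range Sum.inr := by
      ext (v | i) <;> simp [hWd]
    set U : Set V := Sum.inl ⁻¹' W with hU
    have hcard : W.ncard = U.ncard + d := by
      rw [hWU, Set.ncard_union_eq, Set.ncard_image_of_injective _ Sum.inl_injective,
        ← Set.image_univ, Set.ncard_image_of_injective _ Sum.inr_injective]
      · simp
      · rw [Set.disjoint_left]
        rintro _ ⟨v, _, rfl⟩ ⟨i, hi⟩
        simp at hi
    have hval : ∀ x : ((⊤ : (G.joinComplete d).Subgraph).deleteVerts W).verts,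
        ∃ v : (Uᶜ : Set V), (x : V ⊕ Fin d) = Sum.inl (v : V) := by
      rintro ⟨v | i, hx⟩
      · exact ⟨⟨v, by simpa [hU] using hx⟩, rfl⟩
      · exact ((by simpa using hx : Sum.inr i ∉ W) (hWd i)).elim
    choose p hp using hval
    let e : ((⊤ : (G.joinComplete d).Subgraph).deleteVerts W).coe ≃g G.induce Uᶜ :=
      { toFun := p
        invFun := fun v => ⟨Sum.inl v, trivial, v.2⟩
        left_inv := fun x => Subtype.ext (hp x).symm
        right_inv := fun v => Subtype.ext (Sum.inl_injective (hp _).symm)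
        map_rel_iff' := by
          intro x y
          have hx : (x : V ⊕ Fin d) ∉ W := by simpa using x.2
          have hy : (y : V ⊕ Fin d) ∉ W := by simpa using y.2
          simp only [Equiv.coe_fn_mk, comap_adj, Function.Embedding.subtype_apply,
            Subgraph.coe_adj, Subgraph.deleteVerts_adj, Subgraph.verts_top, Set.mem_univ,
            hx, hy, not_false_eq_true, true_and, Subgraph.top_adj]
          rw [hp x, hp y, joinComplete_adj_inl_inl] }
    have := e.ncard_oddComponents_le
    have := h U
    omega

theorem SimpleGraph.exists_edgeCover_of_isPerfectMatching_joinComplete [Fintype V]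
    {G : SimpleGraph V} {d : ℕ} (hG : ∀ v, ∃ w, G.Adj v w)
    {M : (G.joinComplete d).Subgraph} (hM : M.IsPerfectMatching) :
    ∃ S ⊆ G.edgeSet, (∀ v, ∃ e ∈ S, v ∈ e) ∧ 2 * S.ncard ≤ Fintype.card V + d := by
  rw [Subgraph.isPerfectMatching_iff] at hM
  choose p hp hpu using hM
  have hpp : ∀ x, p (p x) = x := fun x => (hpu _ _ (hp x).symm).symm
  choose b hb using hG
  let g : V → V ⊕ Fin d → Sym2 V := fun v y => Sum.elim (fun w => s(v, w)) (fun _ => s(v, b v)) y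
  let c : V ⊕ Fin d → Option (Sym2 V) := fun x =>
    Sum.elim (fun v => some (g v (p x)))
      (fun _ => Sum.elim (fun w => some (g w x)) (fun _ => none) (p x)) x
  have hc : ∀ x, c (p x) = c x := by
    intro x
    have h := hpp x
    rcases x with v | i
    · rcases hpx : p (Sum.inl v) with w | j
      · rw [hpx] at h
        simp [c, g, h, hpx, Sym2.eq_swap]
      · rw [hpx] at h
        simp [c, g, h, hpx]
    · rcases hpx : p (Sum.inr i) with w | j
      · rw [hpx] at h
        simp [c, g, h, hpx]
      · rw [hpx] at h
        simp [c, h, hpx]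
  let h : V → Sym2 V := fun v => g v (p (Sum.inl v))
  refine ⟨Set.range h, ?_, fun v => ⟨h v, ⟨v, rfl⟩, ?_⟩, ?_⟩
  · rintro _ ⟨v, rfl⟩
    have hadj := (hp (Sum.inl v)).adj_sub
    rcases hpv : p (Sum.inl v) with w | j
    · rw [hpv, joinComplete_adj_inl_inl] at hadj
      simpa [h, g, hpv] using hadj
    · simpa [h, g, hpv] using hb v
  · rcases hpv : p (Sum.inl v) with w | j <;> simp [h, g, hpv]
  · have hle : (Set.range h).ncard ≤ (Finset.univ.image c).card := by
      rw [← Set.ncard_image_of_injective (Set.range h) (Option.some_injective _),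
        ← Set.ncard_coe_finset]
      refine Set.ncard_le_ncard ?_
      rintro _ ⟨_, ⟨v, rfl⟩, rfl⟩
      simp only [Finset.coe_image, Finset.coe_univ, Set.image_univ]
      exact ⟨Sum.inl v, rfl⟩
    have h2 : 2 * (Finset.univ.image c).card ≤ (Finset.univ : Finset (V ⊕ Fin d)).card := by
      refine Finset.mul_card_image_le_card _ _ fun y hy => ?_
      obtain ⟨x, -, rfl⟩ := Finset.mem_image.1 hy
      rw [← Finset.card_pair (hp x).ne]
      refine Finset.card_le_card ?_
      intro z hz
      rcases Finset.mem_insert.1 hz with rfl | hz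
      · simp
      · rw [Finset.mem_singleton.1 hz]
        simp [hc]
    simp only [Finset.card_univ, Fintype.card_sum, Fintype.card_fin] at h2
    omega

theorem SimpleGraph.even_sum_card_neighborFinset_inter [Fintype V] (G : SimpleGraph V)
    (A : Finset V) : Even (∑ v ∈ A, (G.neighborFinset v ∩ A).card) := by
  have h : ∑ v ∈ A, (G.neighborFinset v ∩ A).card =
      ∑ v : (A : Set V), (G.induce (A : Set V)).degree v := by
    rw [← Finset.sum_coe_sort]
    refine Finset.sum_congr rfl fun v _ => ?_
    rw [← card_neighborFinset_eq_degree, ← Finset.card_map (Function.Embedding.subtype _)]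
    congr 1
    ext w
    simp [and_comm]
  rw [h, sum_degrees_eq_twice_card_edges]
  exact even_two_mul _

theorem SimpleGraph.IsRegularOfDegree.le_weight_of_odd_card [Fintype V] {G : SimpleGraph V} {k : ℕ}
    (hreg : G.IsRegularOfDegree k) (hk : 3 ≤ k) (hko : Odd k) {A : Finset V} (hA : Odd A.card) :
    (k : ℤ) ^ 3 - 5 * k + 2 ≤
      (k ^ 2 - k - 2) * (∑ v ∈ A, (G.neighborFinset v \ A).card : ℕ) +
        (k - 1) * (k - 2) * A.card := by
  have hsum : ∑ v ∈ A, (G.neighborFinset v \ A).card +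
      ∑ v ∈ A, (G.neighborFinset v ∩ A).card = k * A.card := by
    rw [← Finset.sum_add_distrib, mul_comm, ← smul_eq_mul, ← Finset.sum_const]
    refine Finset.sum_congr rfl fun v _ => ?_
    rw [Finset.card_sdiff_add_card_inter, card_neighborFinset_eq_degree, hreg.degree_eq]
  have heven := G.even_sum_card_neighborFinset_inter A
  have hinner : ∑ v ∈ A, (G.neighborFinset v ∩ A).card ≤ A.card * (A.card - 1) := by
    rw [← smul_eq_mul]
    refine Finset.sum_le_card_nsmul _ _ _ fun v hv => ?_
    rw [← Finset.card_erase_of_mem hv]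
    refine Finset.card_le_card fun w hw => ?_
    simp only [Finset.mem_inter, mem_neighborFinset] at hw
    exact Finset.mem_erase.2 ⟨hw.1.ne', hw.2⟩
  generalize ∑ v ∈ A, (G.neighborFinset v \ A).card = e at *
  generalize ∑ v ∈ A, (G.neighborFinset v ∩ A).card = i at *
  generalize A.card = c at *
  have hc : 1 ≤ c := hA.pos
  have he : 1 ≤ e := by
    have h1 : Odd (e + i) := hsum ▸ hko.mul hA
    exact (Nat.odd_add.1 h1 |>.2 heven).pos
  have hkz : (3 : ℤ) ≤ k := by exact_mod_cast hk
  rcases le_or_gt c k with hck | hck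
  · have h1 : (1 : ℤ) ≤ c := by exact_mod_cast hc
    have hke : (k : ℤ) ≤ e := by
      zify [hc] at hsum hinner hck
      nlinarith [mul_nonneg (sub_nonneg.2 h1) (sub_nonneg.2 hck)]
    nlinarith [mul_le_mul_of_nonneg_left hke (show (0 : ℤ) ≤ k ^ 2 - k - 2 by nlinarith),
      mul_le_mul_of_nonneg_left h1 (show (0 : ℤ) ≤ (k - 1) * (k - 2) by nlinarith)]
  · have hck2 : (k : ℤ) + 2 ≤ c := by
      obtain ⟨a, rfl⟩ := hko
      obtain ⟨b, rfl⟩ := hA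
      push_cast
      omega
    have h1 : (1 : ℤ) ≤ e := by exact_mod_cast he
    nlinarith [mul_le_mul_of_nonneg_left h1 (show (0 : ℤ) ≤ k ^ 2 - k - 2 by nlinarith),
      mul_le_mul_of_nonneg_left hck2 (show (0 : ℤ) ≤ (k - 1) * (k - 2) by nlinarith)]

theorem SimpleGraph.IsRegularOfDegree.sum_card_neighborFinset_inter_le [Fintype V]
    {G : SimpleGraph V} {k : ℕ} (hreg : G.IsRegularOfDegree k) (U A : Finset V) :
    ∑ v ∈ A, (G.neighborFinset v ∩ U).card ≤ k * U.card := by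
  have h := Finset.sum_card_bipartiteAbove_eq_sum_card_bipartiteBelow (s := A) (t := U) G.Adj
  have h1 : ∀ v, U.bipartiteAbove G.Adj v = G.neighborFinset v ∩ U := by
    intro v
    ext w
    simp [and_comm]
  simp only [h1] at h
  rw [h, mul_comm, ← smul_eq_mul]
  refine Finset.sum_le_card_nsmul _ _ _ fun u _ => ?_
  rw [← hreg.degree_eq u, ← card_neighborFinset_eq_degree]
  refine Finset.card_le_card fun w hw => ?_
  simpa [G.adj_comm] using (Finset.mem_filter.1 hw).2

theorem SimpleGraph.IsRegularOfDegree.ncard_oddComponents_mul_le [Fintype V] {G : SimpleGraph V}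
    {k : ℕ} (hreg : G.IsRegularOfDegree k) (hk : 3 ≤ k) (hko : Odd k) (U : Set V) :
    ((k : ℤ) ^ 3 - 5 * k + 2) * (G.induce Uᶜ).oddComponents.ncard ≤
      (k ^ 2 - k - 2) * (k * U.ncard) + (k - 1) * (k - 2) * (Fintype.card V - U.ncard) := by
  set H := G.induce Uᶜ with hH
  have hkz : (3 : ℤ) ≤ k := by exact_mod_cast hk
  have ha : (0 : ℤ) ≤ k ^ 2 - k - 2 := by nlinarith
  have hb : (0 : ℤ) ≤ (k - 1) * (k - 2) := by nlinarith
  let φ : V → ℤ := fun v =>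
    (k ^ 2 - k - 2) * ((G.neighborFinset v ∩ U.toFinset).card : ℕ) + (k - 1) * (k - 2)
  have hφ : ∀ v, 0 ≤ φ v := fun v => by positivity
  have hcomp : ∀ C : H.ConnectedComponent, Odd C.supp.ncard →
      (k : ℤ) ^ 3 - 5 * k + 2 ≤ ∑ v with H.connectedComponentMk v = C, φ v := by
    intro C hC
    let A : Finset V := ({v | H.connectedComponentMk v = C} : Finset (Uᶜ : Set V)).map
      (Function.Embedding.subtype _)
    have hAC : A.card = C.supp.ncard := by
      rw [Finset.card_map, ← Set.ncard_coe_finset]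
      congr 1
      ext v
      simp
    have hsum : ∑ v with H.connectedComponentMk v = C, φ v = ∑ v ∈ A, φ v := by
      rw [Finset.sum_map]
      rfl
    rw [hsum]
    refine (hreg.le_weight_of_odd_card hk hko (hAC ▸ hC : Odd A.card)).trans ?_
    simp only [φ]
    rw [Finset.sum_add_distrib, ← Finset.mul_sum, Finset.sum_const, nsmul_eq_mul,
      mul_comm (A.card : ℤ)]
    gcongr
    push_cast
    gcongr with v hv
    intro w hw
    obtain ⟨v', hv', rfl⟩ := Finset.mem_map.1 hv
    simp only [Finset.mem_sdiff, mem_neighborFinset, Finset.mem_inter, Set.mem_toFinset] at hw ⊢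
    refine ⟨hw.1, ?_⟩
    by_contra hwU
    refine hw.2 (Finset.mem_map.2 ⟨⟨w, hwU⟩, ?_, rfl⟩)
    simp only [Finset.mem_filter, Finset.mem_univ, true_and] at hv' ⊢
    rw [← hv']
    refine ConnectedComponent.sound (Adj.reachable ?_)
    simpa [hH] using hw.1.symm
  have htotal : ((k : ℤ) ^ 3 - 5 * k + 2) * H.oddComponents.ncard ≤
      ∑ v : (Uᶜ : Set V), φ v := by
    rw [← Finset.sum_fiberwise Finset.univ H.connectedComponentMk,
      Set.ncard_eq_toFinset_card', mul_comm, ← nsmul_eq_mul]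
    refine (Finset.card_nsmul_le_sum _ _ _ fun C hC => hcomp C (by simpa using hC)).trans ?_
    exact Finset.sum_le_sum_of_subset_of_nonneg (Finset.subset_univ _)
      fun C _ _ => Finset.sum_nonneg fun v _ => hφ v
  refine htotal.trans ?_
  have hcompl : ∑ v : (Uᶜ : Set V), φ v = ∑ v ∈ U.toFinsetᶜ, φ v := by
    exact (Finset.sum_subtype _ (by simp) _).symm
  rw [hcompl]
  simp only [φ]
  rw [Finset.sum_add_distrib, ← Finset.mul_sum, Finset.sum_const, nsmul_eq_mul,
    mul_comm (Finset.card _ : ℤ), Set.ncard_eq_toFinset_card' U, Finset.card_compl,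
    Nat.cast_sub (Finset.card_le_univ _)]
  gcongr
  exact_mod_cast hreg.sum_card_neighborFinset_inter_le U.toFinset U.toFinsetᶜ

theorem SimpleGraph.IsRegularOfDegree.ncard_oddComponents_sub_le [Fintype V] {G : SimpleGraph V}
    {k : ℕ} (hreg : G.IsRegularOfDegree k) (hconn : G.Connected) (hk : 3 ≤ k) (hko : Odd k)
    (U : Set V) :
    ((k : ℤ) ^ 3 - 3 * k) * ((G.induce Uᶜ).oddComponents.ncard - U.ncard) ≤
      (k - 1) * (k - 2) * Fintype.card V + 2 * (k - 1) := by
  have h1 := hreg.ncard_oddComponents_mul_le hk hko U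
  have h2 := ncard_add_card_connectedComponent_le hreg hconn U
  have h3 : (G.induce Uᶜ).oddComponents.ncard ≤ Nat.card (G.induce Uᶜ).ConnectedComponent :=
    Set.ncard_le_card _
  generalize (G.induce Uᶜ).oddComponents.ncard = q at *
  generalize U.ncard = s at *
  have h4 : (s : ℤ) + q ≤ k * s + 1 := by exact_mod_cast (Nat.add_le_add_left h3 s).trans h2
  have hkz : (0 : ℤ) ≤ 2 * (k - 1) := by
    have : (3 : ℤ) ≤ k := by exact_mod_cast hk
    linarith
  nlinarith [mul_le_mul_of_nonneg_left h4 hkz]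

/-- For a connected `k`-regular graph with `k ≥ 3` odd:
`es_Δ(G) ≤ ((k³+k²−6k+2)n + 2k − 2)/(2(k³−3k))`. -/
theorem stmt_10 [Fintype V] (G : SimpleGraph V) (k : ℕ) (hk : 3 ≤ k) (hko : Odd k)
    (hreg : G.IsRegularOfDegree k) (hconn : G.Connected) :
    (G.esDelta : ℝ) ≤
      (((k : ℝ) ^ 3 + (k : ℝ) ^ 2 - 6 * k + 2) * Fintype.card V + 2 * k - 2) /
        (2 * ((k : ℝ) ^ 3 - 3 * k)) := by
  have : Nonempty V := hconn.nonempty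
  have heven : Even (Fintype.card V) := by
    have h := G.sum_degrees_eq_twice_card_edges
    simp only [hreg.degree_eq, Finset.sum_const, Finset.card_univ, smul_eq_mul] at h
    have h2 : Even (Fintype.card V * k) := h ▸ even_two_mul _
    exact (Nat.even_mul.1 h2).resolve_right (Nat.not_even_iff_odd.2 hko)
  obtain ⟨U₀, hU₀⟩ := Finite.exists_max
    fun U : Set V => ((G.induce Uᶜ).oddComponents.ncard : ℤ) - U.ncard
  have hnonneg := hU₀ ∅
  simp only [Set.ncard_empty] at hnonneg
  obtain ⟨d, hd⟩ : ∃ d : ℕ, ((G.induce U₀ᶜ).oddComponents.ncard : ℤ) - U₀.ncard = d :=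
    Int.eq_ofNat_of_zero_le (by omega)
  have hdeven : Even (Fintype.card V + d) := by
    have hpar := (G.induce U₀ᶜ).odd_ncard_oddComponents
    have hcompl : U₀.ncard + Nat.card (U₀ᶜ : Set V) = Fintype.card V := by
      rw [Nat.card_coe_set_eq, Set.ncard_add_ncard_compl, Nat.card_eq_fintype_card]
    rw [Nat.odd_iff, Nat.odd_iff] at hpar
    rw [Nat.even_iff] at heven ⊢
    omega
  obtain ⟨M, hM⟩ := exists_isPerfectMatching_joinComplete (G := G) hdeven fun U => by
    have := hU₀ U
    omega
  obtain ⟨S, hSG, hcov, hS⟩ := exists_edgeCover_of_isPerfectMatching_joinComplete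
    (fun v => (G.degree_pos_iff_exists_adj v).1 (by rw [hreg.degree_eq]; omega)) hM
  have hes := esDelta_le_of_edgeCover hreg hSG hcov
  have hbound := hreg.ncard_oddComponents_sub_le hconn hk hko U₀
  rw [hd] at hbound
  have hboundR : ((k : ℝ) ^ 3 - 3 * k) * d ≤
      (k - 1) * (k - 2) * Fintype.card V + 2 * (k - 1) := by exact_mod_cast hbound
  have hesR : 2 * (G.esDelta : ℝ) ≤ Fintype.card V + d := by
    exact_mod_cast (Nat.mul_le_mul_left 2 hes).trans hS
  have hkR : (3 : ℝ) ≤ k := by exact_mod_cast hk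
  have hK : 0 < (k : ℝ) ^ 3 - 3 * k := by
    nlinarith [mul_le_mul hkR hkR (by norm_num) (by linarith)]
  rw [le_div_iff₀ (by linarith)]
  nlinarith [mul_le_mul_of_nonneg_left hesR hK.le]
end
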